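/- Let Λ be a right 4-Nakayama artin algebra and let M be a finitely generated indecomposable local right Λ-module. If M is 3-factor serial, then l(M) = 4. -/

import Mathlib

/-! Basic definitions for (right) modules over a ring: radical, socle, length,
uniserial, local, indecomposable, `n`-factor serial, right `n`-Nakayama algebras,
Nakayama algebras and almost split sequences. -/

universe u v w

section ModuleDefs

variable (A : Type v) [Ring A] (M : Type w) [AddCommGroup M] [Module A M]

/-- The composition length of a module, i.e. the Krull dimension of its submodule lattice. -/
noncomputable def moduleLength : WithBot ℕ∞ := Order.krullDim (Submodule A M)

/-- The radical of a module: the intersection of all its maximal submodules. -/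
def moduleRad : Submodule A M := sInf {N : Submodule A M | IsCoatom N}

/-- The socle of a module: the sum of all its simple submodules. -/
def moduleSoc : Submodule A M := sSup {N : Submodule A M | IsAtom N}

variable {A M}

/-- The radical of a submodule `N`, viewed as a submodule of the ambient module. -/
def radOf (N : Submodule A M) : Submodule A M :=
  Submodule.map N.subtype (moduleRad A ↥N)

/-- The socle of a submodule `N`, viewed as a submodule of the ambient module. -/
def socOf (N : Submodule A M) : Submodule A M :=
  Submodule.map N.subtype (moduleSoc A ↥N)

variable (A M)

/-- The iterated radical `rad^n(M)`, as a submodule of `M`. -/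
def radPow : ℕ → Submodule A M
  | 0 => ⊤
  | n + 1 => radOf (radPow n)

/-- A module is uniserial if its submodules are totally ordered by inclusion. -/
def IsUniserialModule : Prop := ∀ N P : Submodule A M, N ≤ P ∨ P ≤ N

/-- A module is local if it has a unique maximal submodule. -/
def IsLocalModule : Prop := ∃! N : Submodule A M, IsCoatom N

/-- A module is colocal if its socle is a simple submodule. -/
def IsColocalModule : Prop := IsAtom (moduleSoc A M)

/-- A module is indecomposable if it is nonzero and is not the direct sum of two
nonzero submodules. -/
def IsIndecModule : Prop :=
  Nontrivial M ∧ ∀ N P : Submodule A M, IsCompl N P → N = ⊥ ∨ P = ⊥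

/-- The Loewy length of a module: the least `n` with `rad^n(M) = 0`. -/
noncomputable def loewyLength : ℕ := sInf {n : ℕ | radPow A M n = ⊥}

/-- A module `M` of length `l` is `n`-factor serial (`l ≥ n > 1`) if it is not uniserial,
`M/rad^{l-n}(M)` is uniserial and `M/rad^{l-n+1}(M)` is not uniserial. -/
def IsNFactorSerial (n : ℕ) : Prop :=
  1 < n ∧ ¬ IsUniserialModule A M ∧
  ∃ l : ℕ, moduleLength A M = l ∧ n ≤ l ∧
    IsUniserialModule A (M ⧸ radPow A M (l - n)) ∧
    ¬ IsUniserialModule A (M ⧸ radPow A M (l - n + 1))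

/-- `M` is `n`-factor serial, where `1`-factor serial means uniserial. -/
def IsFactorSerial (n : ℕ) : Prop :=
  (n = 1 ∧ IsUniserialModule A M) ∨ IsNFactorSerial A M n

end ModuleDefs

section AlgebraDefs

variable (Λ : Type u) [Ring Λ]

/-- A ring `Λ` is right `n`-Nakayama if every finitely generated indecomposable right
`Λ`-module is `i`-factor serial for some `1 ≤ i ≤ n`, and there is at least one finitely
generated indecomposable `n`-factor serial right `Λ`-module.  Right `Λ`-modules are
realized as left `Λᵐᵒᵖ`-modules. -/
def IsRightNNakayama (n : ℕ) : Prop :=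
  (∀ M : ModuleCat.{u} Λᵐᵒᵖ, Module.Finite Λᵐᵒᵖ M → IsIndecModule Λᵐᵒᵖ M →
      ∃ i, 1 ≤ i ∧ i ≤ n ∧ IsFactorSerial Λᵐᵒᵖ M i) ∧
  ∃ M : ModuleCat.{u} Λᵐᵒᵖ, Module.Finite Λᵐᵒᵖ M ∧ IsIndecModule Λᵐᵒᵖ M ∧
    IsNFactorSerial Λᵐᵒᵖ M n

/-- A ring `Λ` is a Nakayama algebra if every finitely generated indecomposable projective
right `Λ`-module and every finitely generated indecomposable projective left `Λ`-module is
uniserial. -/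
def IsNakayamaAlgebra : Prop :=
  (∀ M : ModuleCat.{u} Λᵐᵒᵖ, Module.Finite Λᵐᵒᵖ M → Module.Projective Λᵐᵒᵖ M →
      IsIndecModule Λᵐᵒᵖ M → IsUniserialModule Λᵐᵒᵖ M) ∧
  (∀ M : ModuleCat.{u} Λ, Module.Finite Λ M → Module.Projective Λ M →
      IsIndecModule Λ M → IsUniserialModule Λ M)

end AlgebraDefs

section AlmostSplit

variable {A : Type v} [Ring A]

/-- A pair of maps `f : X → Y`, `g : Y → Z` is an almost split (Auslander-Reiten) sequence
if `0 → X → Y → Z → 0` is a non-split short exact sequence with `X` and `Z` indecomposable,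
such that every homomorphism `V → Z` from a finitely generated module which is not a split
epimorphism factors through `g`. -/
def IsAlmostSplitSequence {X Y Z : Type w} [AddCommGroup X] [Module A X]
    [AddCommGroup Y] [Module A Y] [AddCommGroup Z] [Module A Z]
    (f : X →ₗ[A] Y) (g : Y →ₗ[A] Z) : Prop :=
  Function.Injective f ∧ Function.Surjective g ∧ LinearMap.range f = LinearMap.ker g ∧
  (¬ ∃ s : Z →ₗ[A] Y, g ∘ₗ s = LinearMap.id) ∧
  IsIndecModule A X ∧ IsIndecModule A Z ∧
  ∀ V : ModuleCat.{w} A, Module.Finite A V →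
    ∀ h : V →ₗ[A] Z, (¬ ∃ s : Z →ₗ[A] V, h ∘ₗ s = LinearMap.id) →
      ∃ k : V →ₗ[A] Y, g ∘ₗ k = h

end AlmostSplit

section LargestBelow

variable {A : Type v} [Ring A] {M : Type w} [AddCommGroup M] [Module A M]

/-- `Q` is the largest submodule strictly contained in `P`. -/
def IsLargestBelow (Q P : Submodule A M) : Prop := Q < P ∧ ∀ R, R < P → R ≤ Q

theorem IsLargestBelow.covBy {Q P : Submodule A M} (h : IsLargestBelow Q P) : Q ⋖ P :=
  ⟨h.1, fun _ hQ hP => (h.2 _ hP).not_gt hQ⟩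

theorem IsLargestBelow.exists_smul_eq {Q P : Submodule A M} (h : IsLargestBelow Q P)
    {x y : M} (hy : y ∈ P) (hyQ : y ∉ Q) (hx : x ∈ P) : ∃ a : A, a • y = x := by
  have hle : Submodule.span A {y} ≤ P := by simpa using hy
  have heq : Submodule.span A {y} = P := by
    by_contra hne
    exact hyQ (h.2 _ (lt_of_le_of_ne hle hne) (Submodule.mem_span_singleton_self y))
  rw [← heq] at hx
  exact Submodule.mem_span_singleton.1 hx

theorem CovBy.exists_sub_smul_mem {Q P : Submodule A M} (h : Q ⋖ P)
    {x y : M} (hy : y ∈ P) (hyQ : y ∉ Q) (hx : x ∈ P) : ∃ a : A, x - a • y ∈ Q := by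
  have hle : Q ⊔ Submodule.span A {y} ≤ P := sup_le h.le (by simpa using hy)
  have heq : Q ⊔ Submodule.span A {y} = P := by
    rcases h.eq_or_eq le_sup_left hle with h' | h'
    · exact absurd (h' ▸ Submodule.mem_sup_right (Submodule.mem_span_singleton_self y)) hyQ
    · exact h'
  rw [← heq] at hx
  obtain ⟨q, hq, s, hs, rfl⟩ := Submodule.mem_sup.1 hx
  obtain ⟨a, rfl⟩ := Submodule.mem_span_singleton.1 hs
  exact ⟨a, by simpa using hq⟩

theorem IsLargestBelow.moduleRad_eq {Q : Submodule A M} (h : IsLargestBelow Q ⊤) :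
    moduleRad A M = Q := by
  have hQ : IsCoatom Q := covBy_top_iff.1 h.covBy
  refine le_antisymm (sInf_le hQ) (le_sInf fun P hP => ?_)
  exact ((hP.le_iff.1 (h.2 P hP.lt_top)).resolve_left h.1.ne).le

end LargestBelow

section Fork

variable {A : Type v} [Ring A] {N : Type w} [AddCommGroup N] [Module A N]

/-- Submodules describing two local layers `N > L > K` of `N` below which the submodule lattice
branches into two distinct maximal submodules `K₁`, `K₂` of `K`. -/
structure IsFork (L K K₁ K₂ : Submodule A N) : Prop where
  top : IsLargestBelow L ⊤
  mid : IsLargestBelow K L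
  left : K₁ ⋖ K
  right : K₂ ⋖ K
  ne : K₁ ≠ K₂

/-- The relations identifying `K₂ ⊆ N` with the copy of `K₂` in `L ⧸ K₁`, up to `K₁ ⊓ K₂`. -/
def glueRel (L K₁ K₂ : Submodule A N) : Submodule A (N × L) :=
  K₂.comap (LinearMap.fst A N L) ⊓
    K₁.comap (LinearMap.fst A N L + L.subtype ∘ₗ LinearMap.snd A N L)

theorem mem_glueRel {L K₁ K₂ : Submodule A N} {x : N × L} :
    x ∈ glueRel L K₁ K₂ ↔ x.1 ∈ K₂ ∧ x.1 + x.2 ∈ K₁ := Iff.rfl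

/-- The amalgam of `N` and `L ⧸ K₁` along `K₂`. -/
abbrev Glue (L K₁ K₂ : Submodule A N) := (N × L) ⧸ glueRel L K₁ K₂

variable {L K K₁ K₂ : Submodule A N}

variable (L K₁ K₂) in
/-- The canonical map from `N` to the amalgam. -/
def glueInl : N →ₗ[A] Glue L K₁ K₂ := (glueRel L K₁ K₂).mkQ ∘ₗ LinearMap.inl A N L

variable (L K₁ K₂) in
/-- The canonical map from `L` to the amalgam. -/
def glueInr : L →ₗ[A] Glue L K₁ K₂ := (glueRel L K₁ K₂).mkQ ∘ₗ LinearMap.inr A N L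

theorem exists_glueInl_add_glueInr (x : Glue L K₁ K₂) :
    ∃ n l, x = glueInl L K₁ K₂ n + glueInr L K₁ K₂ l := by
  obtain ⟨⟨n, l⟩, rfl⟩ := Submodule.mkQ_surjective _ x
  refine ⟨n, l, ?_⟩
  simp only [glueInl, glueInr, LinearMap.comp_apply, ← map_add]
  simp

theorem glueInl_add_glueInr_eq_zero {n : N} {l : L} :
    glueInl L K₁ K₂ n + glueInr L K₁ K₂ l = 0 ↔ n ∈ K₂ ∧ n + l ∈ K₁ := by
  simp only [glueInl, glueInr, LinearMap.comp_apply, ← map_add]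
  rw [Submodule.mkQ_apply, Submodule.Quotient.mk_eq_zero, mem_glueRel]
  simp

theorem glueInl_eq_zero {n : N} : glueInl L K₁ K₂ n = 0 ↔ n ∈ K₁ ∧ n ∈ K₂ := by
  simpa [and_comm] using
    glueInl_add_glueInr_eq_zero (L := L) (K₁ := K₁) (K₂ := K₂) (n := n) (l := 0)

theorem glueInr_eq_zero {l : L} : glueInr L K₁ K₂ l = 0 ↔ (l : N) ∈ K₁ := by
  simpa using glueInl_add_glueInr_eq_zero (L := L) (K₁ := K₁) (K₂ := K₂) (n := 0) (l := l)

theorem glueInr_eq_glueInl {l : L} (h : (l : N) ∈ K₂) :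
    glueInr L K₁ K₂ l = glueInl L K₁ K₂ l := by
  have := (glueInl_add_glueInr_eq_zero (L := L) (K₁ := K₁) (K₂ := K₂) (n := -l) (l := l)).2
    ⟨neg_mem h, by simp⟩
  rw [map_neg, neg_add_eq_zero] at this
  exact this.symm

namespace IsFork

theorem sup_eq (h : IsFork L K K₁ K₂) : K₁ ⊔ K₂ = K :=
  WCovBy.sup_eq h.left.wcovBy h.right.wcovBy h.ne

theorem exists_right_notMem_left (h : IsFork L K K₁ K₂) : ∃ x ∈ K₂, x ∉ K₁ := by
  by_contra! hle
  rcases h.right.eq_or_eq hle h.left.le with h' | h'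
  · exact h.ne h'
  · exact h.left.ne h'

/-- No map from `L` to a quotient of `N` by `K₁ ⊓ K₂` kills `K₁` and is the identity on `K₂`. -/
theorem false_of_extension (h : IsFork L K K₁ K₂) {Y : Type*} [AddCommGroup Y] [Module A Y]
    (e : N →ₗ[A] Y) (he : Function.Surjective e) (hker : ∀ n, e n = 0 ↔ n ∈ K₁ ∧ n ∈ K₂)
    (f : L →ₗ[A] Y) (hf₁ : ∀ l : L, (l : N) ∈ K₁ → f l = 0)
    (hf₂ : ∀ l : L, (l : N) ∈ K₂ → f l = e l) : False := by
  have hKL := h.mid.1.le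
  have hK₁ := h.left.le
  have hK₂ := h.right.le
  have heq : ∀ x y : N, e x = e y → x - y ∈ K₁ ∧ x - y ∈ K₂ := fun x y hxy => by
    rw [← hker, map_sub, hxy, sub_self]
  have hfK : ∀ l : L, (l : N) ∈ K → ∃ k ∈ K₂, f l = e k := by
    intro l hl
    rw [← h.sup_eq] at hl
    obtain ⟨x, hx, y, hy, hxy⟩ := Submodule.mem_sup.1 hl
    have hl' : l = ⟨x, hKL (hK₁ hx)⟩ + ⟨y, hKL (hK₂ hy)⟩ := Subtype.ext hxy.symm
    exact ⟨y, hy, by rw [hl', map_add, hf₁ _ hx, hf₂ _ hy, zero_add]⟩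
  set F : Submodule A N := (LinearMap.range f).comap e
  have hLF : ¬ L ≤ F := by
    intro hle
    obtain ⟨k, hk, hk₂⟩ := SetLike.exists_of_lt h.right.lt
    obtain ⟨y, hy⟩ := hle (hKL hk)
    have hyK : (y : N) ∉ K := by
      intro hyK
      obtain ⟨k', hk', hyk'⟩ := hfK y hyK
      have := (heq _ _ (hy.symm.trans hyk')).2
      exact hk₂ (by simpa using add_mem this hk')
    obtain ⟨x, hx, hxK⟩ := SetLike.exists_of_lt h.mid.1
    obtain ⟨z, hz⟩ := hle hx
    obtain ⟨a, ha⟩ := h.mid.covBy.exists_sub_smul_mem y.2 hyK z.2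
    obtain ⟨k', hk', hzk'⟩ := hfK (z - a • y) (by simpa using ha)
    have hxk : e x = e (a • k + k') := by
      rw [map_add, map_smul, ← hzk', ← hz, ← hy, map_sub, map_smul]
      abel
    have := add_mem (hK₂ (heq _ _ hxk).2) (add_mem (K.smul_mem a hk) (hK₂ hk'))
    exact hxK (by simpa using this)
  have hFK : F ≤ K := by
    have hFL : F ≤ L := h.top.2 F (lt_top_iff_ne_top.2 fun hFt => hLF (hFt ▸ le_top))
    exact h.mid.2 F (lt_of_le_of_ne hFL fun hFL' => hLF hFL'.ge)
  obtain ⟨y, hy, hyK⟩ := SetLike.exists_of_lt h.mid.1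
  obtain ⟨k, hky⟩ := he (f ⟨y, hy⟩)
  have hk : k ∈ K := hFK ⟨_, hky.symm⟩
  obtain ⟨x, hx, hx₁⟩ := h.exists_right_notMem_left
  have hxL : x ∈ L := hKL (hK₂ hx)
  have hgen : ∀ z : L, (z : N) ∉ K → ∀ n ∈ K₁, f z ≠ e n := by
    intro z hz n hn hzn
    obtain ⟨a, ha⟩ := h.mid.exists_smul_eq z.2 hz hxL
    have hxe : e x = e (a • n) := by
      rw [map_smul, ← hzn, ← map_smul, ← hf₂ ⟨x, hxL⟩ hx]
      congr 1
      exact Subtype.ext ha.symm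
    exact hx₁ (by simpa using add_mem (heq _ _ hxe).1 (K₁.smul_mem a hn))
  have hk₁ : k ∉ K₁ := fun hk₁ => hgen ⟨y, hy⟩ hyK k hk₁ hky.symm
  obtain ⟨a, ha⟩ := h.mid.exists_smul_eq hy hyK hxL
  have hxak : e x = e (a • k) := by
    rw [map_smul, hky, ← map_smul, ← hf₂ ⟨x, hxL⟩ hx]
    congr 1
    exact Subtype.ext ha.symm
  have hak₁ : a • k ∉ K₁ := fun hak =>
    hx₁ (by simpa using add_mem (heq _ _ hxak).1 hak)
  obtain ⟨b, hb⟩ := h.left.exists_sub_smul_mem (K.smul_mem a hk) hak₁ hk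
  refine hgen (⟨y, hy⟩ - b • a • ⟨y, hy⟩) ?_ _ hb
    (by rw [map_sub, map_sub, map_smul, map_smul, map_smul, map_smul, hky])
  intro hmem
  have hax : a • y ∈ K := ha ▸ hK₂ hx
  exact hyK (by simpa using add_mem hmem (K.smul_mem b hax))

/-- The projection of the amalgam onto `L ⧸ K`. -/
def glueSnd (h : IsFork L K K₁ K₂) : Glue L K₁ K₂ →ₗ[A] (L ⧸ K.comap L.subtype) :=
  (glueRel L K₁ K₂).liftQ ((K.comap L.subtype).mkQ ∘ₗ LinearMap.snd A N L) (by
    rintro ⟨n, l⟩ hx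
    obtain ⟨h₂, h₁⟩ := mem_glueRel.1 hx
    have := sub_mem (h.left.le h₁) (h.right.le h₂)
    simpa [Submodule.Quotient.mk_eq_zero] using this)

/-- The projection of the amalgam onto `N ⧸ L`. -/
def glueFst (h : IsFork L K K₁ K₂) : Glue L K₁ K₂ →ₗ[A] (N ⧸ L) :=
  (glueRel L K₁ K₂).liftQ (L.mkQ ∘ₗ LinearMap.fst A N L) (by
    rintro ⟨n, l⟩ hx
    have := h.mid.1.le (h.right.le (mem_glueRel.1 hx).1)
    simpa [Submodule.Quotient.mk_eq_zero] using this)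

theorem glueSnd_eq_zero (h : IsFork L K K₁ K₂) {n : N} {l : L} :
    h.glueSnd (glueInl L K₁ K₂ n + glueInr L K₁ K₂ l) = 0 ↔ (l : N) ∈ K := by
  simp [glueSnd, glueInl, glueInr, Submodule.Quotient.mk_eq_zero]

theorem glueFst_eq_zero (h : IsFork L K K₁ K₂) {n : N} {l : L} :
    h.glueFst (glueInl L K₁ K₂ n + glueInr L K₁ K₂ l) = 0 ↔ n ∈ L := by
  simp [glueFst, glueInl, glueInr, Submodule.Quotient.mk_eq_zero]

theorem isCoatom_ker_glueSnd (h : IsFork L K K₁ K₂) : IsCoatom (LinearMap.ker h.glueSnd) := by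
  have : IsSimpleModule A (L ⧸ K.comap L.subtype) := by
    rw [isSimpleModule_iff_isCoatom]
    refine ⟨fun htop => h.mid.1.not_ge (Submodule.comap_subtype_eq_top.1 htop), fun P hP => ?_⟩
    obtain ⟨y, hyP, hyK⟩ := SetLike.exists_of_lt hP
    refine eq_top_iff.2 fun l _ => ?_
    obtain ⟨a, ha⟩ := h.mid.exists_smul_eq y.2 hyK l.2
    exact (Subtype.ext ha : a • y = l) ▸ P.smul_mem a hyP
  refine LinearMap.isCoatom_ker_of_surjective (LinearMap.range_eq_top.1 ?_)
  rw [glueSnd, Submodule.range_liftQ, LinearMap.range_eq_top]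
  exact (Submodule.mkQ_surjective _).comp LinearMap.snd_surjective

theorem isCoatom_ker_glueFst (h : IsFork L K K₁ K₂) : IsCoatom (LinearMap.ker h.glueFst) := by
  have : IsSimpleModule A (N ⧸ L) := isSimpleModule_iff_isCoatom.2 (covBy_top_iff.1 h.top.covBy)
  refine LinearMap.isCoatom_ker_of_surjective (LinearMap.range_eq_top.1 ?_)
  rw [glueFst, Submodule.range_liftQ, LinearMap.range_eq_top]
  exact (Submodule.mkQ_surjective _).comp LinearMap.fst_surjective

theorem ker_glueSnd (h : IsFork L K K₁ K₂) :
    LinearMap.ker h.glueSnd = LinearMap.range (glueInl L K₁ K₂) := by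
  ext x
  constructor
  · intro hx
    obtain ⟨n, l, rfl⟩ := exists_glueInl_add_glueInr x
    have hl : (l : N) ∈ K := h.glueSnd_eq_zero.1 hx
    rw [← h.sup_eq] at hl
    obtain ⟨k₁, hk₁, k₂, hk₂, hk⟩ := Submodule.mem_sup.1 hl
    have hl' : l = ⟨k₁, h.mid.1.le (h.left.le hk₁)⟩ + ⟨k₂, h.mid.1.le (h.right.le hk₂)⟩ :=
      Subtype.ext hk.symm
    refine ⟨n + k₂, ?_⟩
    rw [hl', map_add, map_add, glueInr_eq_zero.2 hk₁, glueInr_eq_glueInl hk₂, zero_add]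
  · rintro ⟨n, rfl⟩
    simpa using (h.glueSnd_eq_zero (n := n) (l := 0)).2 (by simp)

theorem moduleRad_glue (h : IsFork L K K₁ K₂) :
    moduleRad A (Glue L K₁ K₂) = L.map (glueInl L K₁ K₂) := by
  refine le_antisymm (fun x hx => ?_) ?_
  · have h₁ := sInf_le (a := LinearMap.ker h.glueSnd) h.isCoatom_ker_glueSnd hx
    have h₂ := sInf_le (a := LinearMap.ker h.glueFst) h.isCoatom_ker_glueFst hx
    rw [h.ker_glueSnd] at h₁
    obtain ⟨n, rfl⟩ := h₁
    exact ⟨n, by simpa using (h.glueFst_eq_zero (n := n) (l := 0)).1 (by simpa using h₂), rfl⟩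
  · rw [← h.top.moduleRad_eq]
    exact Module.map_jacobson_le _

theorem isCompl_eq_bot (h : IsFork L K K₁ K₂) {P Q : Submodule A (Glue L K₁ K₂)}
    (hPQ : IsCompl P Q) (hP : L.map (glueInl L K₁ K₂) ≤ P) : Q = ⊥ := by
  by_contra hQ
  have hdisj : Disjoint Q (LinearMap.range (glueInl L K₁ K₂)) := by
    rw [Submodule.disjoint_def]
    rintro _ hxQ ⟨n, rfl⟩
    by_cases hn : n ∈ L
    · exact (Submodule.disjoint_def.1 hPQ.disjoint) _ (hP ⟨n, hn, rfl⟩) hxQ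
    · exfalso
      obtain ⟨x, hx, hxK⟩ := SetLike.exists_of_lt h.mid.1
      obtain ⟨a, rfl⟩ := h.top.exists_smul_eq (Submodule.mem_top) hn (Submodule.mem_top (x := x))
      have h0 := (Submodule.disjoint_def.1 hPQ.disjoint) _ (hP ⟨_, hx, rfl⟩)
        (by rw [map_smul]; exact Q.smul_mem a hxQ)
      exact hxK (h.left.le (glueInl_eq_zero.1 h0).1)
  have hcoatom := h.ker_glueSnd ▸ h.isCoatom_ker_glueSnd
  have hcompl : IsCompl (LinearMap.range (glueInl L K₁ K₂)) Q := by
    refine ⟨hdisj.symm, codisjoint_iff.2 ?_⟩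
    rcases hcoatom.le_iff.1 (le_sup_left (b := Q)) with h' | h'
    · exact h'
    · exact absurd (disjoint_self.1 (hdisj.mono_right (sup_eq_left.1 h'))) hQ
  have hproj := fun n => Submodule.projectionOnto_apply_left hcompl
    ((glueInl L K₁ K₂).rangeRestrict n)
  refine h.false_of_extension (glueInl L K₁ K₂).rangeRestrict
    (LinearMap.surjective_rangeRestrict _) (fun n => ?_)
    (Submodule.projectionOnto _ _ hcompl ∘ₗ glueInr L K₁ K₂) (fun l hl => ?_) (fun l hl => ?_)
  · rw [← glueInl_eq_zero (L := L), ← Subtype.coe_inj]; rfl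
  · rw [LinearMap.comp_apply, glueInr_eq_zero.2 hl, map_zero]
  · rw [LinearMap.comp_apply, glueInr_eq_glueInl hl]
    exact hproj l

theorem isIndecModule_glue (h : IsFork L K K₁ K₂) : IsIndecModule A (Glue L K₁ K₂) := by
  obtain ⟨x, hx, hxK⟩ := SetLike.exists_of_lt h.mid.1
  refine ⟨⟨glueInl L K₁ K₂ x, 0, fun h0 => hxK (h.left.le (glueInl_eq_zero.1 h0).1)⟩, ?_⟩
  intro P Q hPQ
  have key : ∀ {P Q : Submodule A (Glue L K₁ K₂)} (hPQ : IsCompl P Q),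
      ¬ L.map (glueInl L K₁ K₂) ≤ P →
        ∃ k ∈ K, P.projection Q hPQ (glueInl L K₁ K₂ x) = glueInl L K₁ K₂ k := by
    intro P Q hPQ hP
    have hmem : ∀ l ∈ L, P.projection Q hPQ (glueInl L K₁ K₂ l) ∈ L.map (glueInl L K₁ K₂) := by
      intro l hl
      rw [← h.moduleRad_glue]
      refine Module.map_jacobson_le (P.projection Q hPQ) ⟨_, ?_, rfl⟩
      have : glueInl L K₁ K₂ l ∈ moduleRad A (Glue L K₁ K₂) :=
        h.moduleRad_glue ▸ ⟨l, hl, rfl⟩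
      exact this
    obtain ⟨k, hk, hkx⟩ := hmem x hx
    refine ⟨k, by_contra fun hkK => hP ?_, hkx.symm⟩
    rintro _ ⟨l, hl, rfl⟩
    obtain ⟨a, rfl⟩ := h.mid.exists_smul_eq hk hkK hl
    rw [map_smul, hkx]
    exact P.smul_mem a (Submodule.projection_apply_mem hPQ _)
  by_cases hP : L.map (glueInl L K₁ K₂) ≤ P
  · exact Or.inr (h.isCompl_eq_bot hPQ hP)
  by_cases hQ : L.map (glueInl L K₁ K₂) ≤ Q
  · exact Or.inl (h.isCompl_eq_bot hPQ.symm hQ)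
  exfalso
  obtain ⟨k, hk, hxk⟩ := key hPQ hP
  obtain ⟨k', hk', hxk'⟩ := key hPQ.symm hQ
  have hsum := Submodule.projection_add_projection_eq_self hPQ (glueInl L K₁ K₂ x)
  rw [hxk, hxk', ← map_add, eq_comm, ← sub_eq_zero, ← map_sub] at hsum
  have := add_mem (h.left.le (glueInl_eq_zero.1 hsum).1) (add_mem hk hk')
  exact hxK (by simpa using this)

end IsFork

end Fork

section Radical

variable {A : Type v} [Ring A] {M : Type w} [AddCommGroup M] [Module A M]

theorem isUniserialModule_quotient_iff {P : Submodule A M} :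
    IsUniserialModule A (M ⧸ P) ↔ ∀ Q R, P ≤ Q → P ≤ R → Q ≤ R ∨ R ≤ Q := by
  constructor
  · intro h Q R hQ hR
    have heq : ∀ S, P ≤ S → (S.map P.mkQ).comap P.mkQ = S := fun S hS =>
      Submodule.comap_map_eq_self (by rwa [Submodule.ker_mkQ])
    rw [← heq Q hQ, ← heq R hR]
    exact (h (Q.map P.mkQ) (R.map P.mkQ)).imp (Submodule.comap_mono ·) (Submodule.comap_mono ·)
  · intro h Q R
    simpa only [Submodule.comap_le_comap_iff_of_surjective P.mkQ_surjective] using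
      h (Q.comap P.mkQ) (R.comap P.mkQ) (P.le_comap_mkQ Q) (P.le_comap_mkQ R)

theorem radOf_le (P : Submodule A M) : radOf P ≤ P := Submodule.map_subtype_le _ _

variable (A M) in
theorem radPow_antitone : Antitone (radPow A M) :=
  antitone_nat_of_succ_le fun _ => radOf_le _

variable (A M) in
theorem radPow_one : radPow A M 1 = moduleRad A M :=
  Module.map_jacobson_of_bijective (f := (⊤ : Submodule A M).subtype)
    ⟨Subtype.val_injective, fun x => ⟨⟨x, Submodule.mem_top⟩, rfl⟩⟩

theorem IsCoatom.map_subtype_covBy {P : Submodule A M} {C : Submodule A P} (hC : IsCoatom C) :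
    C.map P.subtype ⋖ P := by
  refine (covBy_iff_coatom_Iic (Submodule.map_subtype_le _ _)).2 ?_
  exact ((Submodule.mapIic P).isCoatom_iff C).2 hC

theorem CovBy.comap_subtype {Q P S : Submodule A M} (h : Q ⋖ P) (hPS : P ≤ S) :
    Q.comap S.subtype ⋖ P.comap S.subtype := by
  have hlt : ∀ {T : Submodule A S}, T < P.comap S.subtype → T.map S.subtype < P := fun hT => by
    have := (Submodule.map_lt_map_iff_of_injective S.subtype_injective).2 hT
    rwa [Submodule.map_comap_subtype, inf_eq_right.2 hPS] at this
  refine ⟨?_, fun T hQT hTP => h.2 ?_ (hlt hTP)⟩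
  · rw [← Submodule.map_lt_map_iff_of_injective S.subtype_injective,
      Submodule.map_comap_subtype, Submodule.map_comap_subtype, inf_eq_right.2 hPS,
      inf_eq_right.2 (h.le.trans hPS)]
    exact h.lt
  · have := (Submodule.map_lt_map_iff_of_injective S.subtype_injective).2 hQT
    rwa [Submodule.map_comap_subtype, inf_eq_right.2 (h.le.trans hPS)] at this

theorem IsLargestBelow.comap_subtype {Q P S : Submodule A M} (h : IsLargestBelow Q P)
    (hPS : P ≤ S) : IsLargestBelow (Q.comap S.subtype) (P.comap S.subtype) := by
  refine ⟨(h.covBy.comap_subtype hPS).lt, fun T hT => Submodule.map_le_iff_le_comap.1 (h.2 _ ?_)⟩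
  have := (Submodule.map_lt_map_iff_of_injective S.subtype_injective).2 hT
  rwa [Submodule.map_comap_subtype, inf_eq_right.2 hPS] at this

theorem isLargestBelow_radOf [IsNoetherian A M] {P : Submodule A M} (hP : P ≠ ⊥)
    (huniq : ∀ Q R, Q ⋖ P → R ⋖ P → Q = R) : IsLargestBelow (radOf P) P := by
  have : Nontrivial P := Submodule.nontrivial_iff_ne_bot.2 hP
  obtain ⟨C, hC, -⟩ := (eq_top_or_exists_le_coatom (⊥ : Submodule A P)).resolve_left bot_ne_top
  have hC' : ∀ C', IsCoatom C' → C' = C := fun C' hC' =>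
    Submodule.map_injective_of_injective P.subtype_injective
      (huniq _ _ hC'.map_subtype_covBy hC.map_subtype_covBy)
  have hrad : moduleRad A P = C :=
    le_antisymm (sInf_le hC) (le_sInf fun C' h => (hC' C' h).ge)
  rw [radOf, hrad]
  refine ⟨hC.map_subtype_covBy.lt, fun R hR => ?_⟩
  obtain ⟨C', h', hle⟩ := (eq_top_or_exists_le_coatom (R.comap P.subtype)).resolve_left
    fun h => hR.not_ge (Submodule.comap_subtype_eq_top.1 h)
  rw [hC' C' h'] at hle
  have := Submodule.map_mono (f := P.subtype) hle
  rwa [Submodule.map_comap_subtype, inf_eq_right.2 hR.le] at this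

theorem isUniserialModule_quotient_radPow {n : ℕ}
    (h : ∀ j < n, IsLargestBelow (radPow A M (j + 1)) (radPow A M j)) :
    IsUniserialModule A (M ⧸ radPow A M n) := by
  have key : ∀ n, (∀ j < n, IsLargestBelow (radPow A M (j + 1)) (radPow A M j)) →
      ∀ P, P ≤ radPow A M n ∨ ∃ j, P = radPow A M j := by
    intro n
    induction n with
    | zero => exact fun _ P => Or.inl le_top
    | succ n ih =>
      intro h P
      rcases ih (fun j hj => h j (hj.trans n.lt_succ_self)) P with hP | hP
      · rcases hP.eq_or_lt with hP | hP
        · exact Or.inr ⟨n, hP⟩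
        · exact Or.inl ((h n n.lt_succ_self).2 P hP)
      · exact Or.inr hP
  refine isUniserialModule_quotient_iff.2 fun Q R hQ hR => ?_
  rcases key n h Q with h' | ⟨i, rfl⟩
  · exact Or.inl (h'.trans hR)
  rcases key n h R with h' | ⟨j, rfl⟩
  · exact Or.inr (h'.trans hQ)
  exact (le_total i j).symm.imp (radPow_antitone A M ·) (radPow_antitone A M ·)

theorem isLargestBelow_radPow [IsNoetherian A M] {n : ℕ} (hne : radPow A M n ≠ ⊥)
    (h : IsUniserialModule A (M ⧸ radPow A M n)) {j : ℕ} (hj : j < n) :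
    IsLargestBelow (radPow A M (j + 1)) (radPow A M j) := by
  refine isLargestBelow_radOf (fun h0 => hne (le_bot_iff.1 (h0 ▸ radPow_antitone A M hj.le)))
    fun Q R hQ hR => ?_
  have hle : ∀ Q, Q ⋖ radPow A M j → radPow A M n ≤ Q := by
    intro Q hQ
    have hcoatom := (covBy_iff_coatom_Iic hQ.le).1 hQ
    rw [← OrderIso.isCoatom_iff (Submodule.mapIic (radPow A M j)).symm] at hcoatom
    have hrad : moduleRad A (radPow A M j) ≤ _ := sInf_le hcoatom
    refine (radPow_antitone A M hj).trans ((Submodule.map_mono hrad).trans ?_)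
    exact (congrArg Subtype.val
      ((Submodule.mapIic (radPow A M j)).apply_symm_apply ⟨Q, hQ.le⟩)).le
  rcases isUniserialModule_quotient_iff.1 h Q R (hle Q hQ) (hle R hR) with hQR | hRQ
  · exact ((hQ.eq_or_eq hQR hR.le).resolve_right hR.ne).symm
  · exact (hR.eq_or_eq hRQ hQ.le).resolve_right hQ.ne

theorem not_isUniserialModule_quotient_radPow_one {C D : Submodule A M} (hC : IsCoatom C)
    (hD : IsCoatom D) (hne : C ≠ D) : ¬ IsUniserialModule A (M ⧸ radPow A M 1) := by
  intro h
  rw [radPow_one] at h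
  rcases isUniserialModule_quotient_iff.1 h C D (sInf_le hC) (sInf_le hD) with hle | hle
  · exact hne ((hC.le_iff.1 hle).resolve_left hD.1).symm
  · exact hne ((hD.le_iff.1 hle).resolve_left hC.1)

/-- A non-local `i`-factor serial module has length `i`. -/
theorem IsFactorSerial.moduleLength_eq {i : ℕ} (h : IsFactorSerial A M i)
    {C D : Submodule A M} (hC : IsCoatom C) (hD : IsCoatom D) (hne : C ≠ D) :
    moduleLength A M = i := by
  have hnot := not_isUniserialModule_quotient_radPow_one hC hD hne
  rcases h with ⟨-, huni⟩ | ⟨-, -, l, hl, hil, huni, -⟩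
  · exact absurd (isUniserialModule_quotient_iff.2 fun Q R _ _ => huni Q R) hnot
  · obtain rfl | hlt := hil.eq_or_lt
    · exact hl
    · refine absurd (isUniserialModule_quotient_iff.2 fun Q R hQ hR => ?_) hnot
      have hle : radPow A M (l - i) ≤ radPow A M 1 := radPow_antitone A M (by omega)
      exact isUniserialModule_quotient_iff.1 huni Q R (hle.trans hQ) (hle.trans hR)

theorem isNoetherian_of_moduleLength_eq {l : ℕ} (h : moduleLength A M = l) :
    IsNoetherian A M := by
  have hlen : Module.length A M ≠ ⊤ := by
    rw [moduleLength, ← Module.coe_length] at h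
    rw [show Module.length A M = (l : ℕ∞) from WithBot.coe_injective h]
    exact ENat.natCast_ne_top l
  exact (isFiniteLength_iff_isNoetherian_isArtinian.1 (Module.length_ne_top_iff.1 hlen)).1

theorem exists_isFork [IsNoetherian A M] {n : ℕ} (hM : ¬ IsUniserialModule A M)
    (h : IsUniserialModule A (M ⧸ radPow A M (n + 2)))
    {Q R : Submodule A M} (hQ : Q ⋖ radPow A M (n + 2)) (hR : R ⋖ radPow A M (n + 2))
    (hQR : Q ≠ R) :
    IsFork ((radPow A M (n + 1)).comap (radPow A M n).subtype)
      ((radPow A M (n + 2)).comap (radPow A M n).subtype)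
      (Q.comap (radPow A M n).subtype) (R.comap (radPow A M n).subtype) := by
  have hne : radPow A M (n + 2) ≠ ⊥ := fun h0 => hM fun P S =>
    isUniserialModule_quotient_iff.1 h P S (h0 ▸ bot_le) (h0 ▸ bot_le)
  have hle₁ : radPow A M (n + 1) ≤ radPow A M n := radPow_antitone A M (by omega)
  have hle₂ : radPow A M (n + 2) ≤ radPow A M n := radPow_antitone A M (by omega)
  refine ⟨?_, (isLargestBelow_radPow hne h (by omega)).comap_subtype hle₁,
    hQ.comap_subtype hle₂, hR.comap_subtype hle₂, fun heq => hQR ?_⟩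
  · simpa using (isLargestBelow_radPow hne h (j := n) (by omega)).comap_subtype le_rfl
  · have := congrArg (Submodule.map (radPow A M n).subtype) heq
    rwa [Submodule.map_comap_subtype, Submodule.map_comap_subtype,
      inf_eq_right.2 (hQ.le.trans hle₂), inf_eq_right.2 (hR.le.trans hle₂)] at this

theorem exists_covBy_radPow [IsNoetherian A M] {n : ℕ} (hM : ¬ IsUniserialModule A M)
    (h : IsUniserialModule A (M ⧸ radPow A M n))
    (h' : ¬ IsUniserialModule A (M ⧸ radPow A M (n + 1))) :
    ∃ Q R, Q ⋖ radPow A M n ∧ R ⋖ radPow A M n ∧ Q ≠ R := by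
  by_contra! huniq
  have hne : radPow A M n ≠ ⊥ := fun h0 => hM fun P S =>
    isUniserialModule_quotient_iff.1 h P S (h0 ▸ bot_le) (h0 ▸ bot_le)
  refine h' (isUniserialModule_quotient_radPow fun j hj => ?_)
  rcases (Nat.lt_succ_iff.1 hj).eq_or_lt with rfl | hj
  · exact isLargestBelow_radOf hne huniq
  · exact isLargestBelow_radPow hne h hj

end Radical

section ForkLength

variable {A : Type v} [Ring A] {N : Type w} [AddCommGroup N] [Module A N]
  {L K K₁ K₂ : Submodule A N}

theorem IsFork.ker_glueFst_ne_ker_glueSnd (h : IsFork L K K₁ K₂) :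
    LinearMap.ker h.glueFst ≠ LinearMap.ker h.glueSnd := by
  intro heq
  obtain ⟨y, hy, hyK⟩ := SetLike.exists_of_lt h.mid.1
  have h₁ := (h.glueFst_eq_zero (n := 0) (l := ⟨y, hy⟩)).2 L.zero_mem
  rw [← LinearMap.mem_ker, heq, LinearMap.mem_ker, h.glueSnd_eq_zero] at h₁
  exact hyK h₁

theorem IsFork.five_le_moduleLength_glue (h : IsFork L K K₁ K₂) :
    5 ≤ moduleLength A (Glue L K₁ K₂) := by
  set K' : Submodule A L := K.comap L.subtype
  have hprod : ∀ {P Q : Submodule A N} {S : Submodule A L}, P < Q → P.prod S < Q.prod S := by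
    intro P Q S hPQ
    obtain ⟨y, hy, hyP⟩ := SetLike.exists_of_lt hPQ
    exact lt_of_le_not_ge (Submodule.prod_mono hPQ.le le_rfl)
      fun hle => hyP (hle (show (y, (0 : L)) ∈ Q.prod S from ⟨hy, S.zero_mem⟩)).1
  have h₀ : glueRel L K₁ K₂ < K₂.prod K' := by
    obtain ⟨x, hx, hx₁⟩ := h.exists_right_notMem_left
    refine lt_of_le_not_ge (fun p hp => ⟨hp.1, ?_⟩) fun hle => hx₁ ?_
    · have := sub_mem (h.left.le (mem_glueRel.1 hp).2) (h.right.le (mem_glueRel.1 hp).1)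
      rwa [add_sub_cancel_left] at this
    · simpa using (mem_glueRel.1 (hle (show (x, (0 : L)) ∈ K₂.prod K' from ⟨hx, K'.zero_mem⟩))).2
  have h₁ : K₂.prod K' < K.prod K' := hprod h.right.lt
  have h₂ : K.prod K' < L.prod K' := hprod h.mid.1
  have h₃ : L.prod K' < (⊤ : Submodule A N).prod K' := hprod h.top.1
  have h₄ : (⊤ : Submodule A N).prod K' < ⊤ := by
    obtain ⟨y, hy, hyK⟩ := SetLike.exists_of_lt h.mid.1
    exact lt_top_iff_ne_top.2 fun heq =>
      hyK (heq ▸ Submodule.mem_top : ((0 : N), (⟨y, hy⟩ : L)) ∈ (⊤ : Submodule A N).prod K').2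
  have l₁ := h₀.le
  have l₂ := l₁.trans h₁.le
  have l₃ := l₂.trans h₂.le
  have l₄ := l₃.trans h₃.le
  let s : LTSeries (Set.Ici (glueRel L K₁ K₂)) :=
    { length := 5
      toFun := ![⟨glueRel L K₁ K₂, le_refl (glueRel L K₁ K₂)⟩,
        ⟨_, l₁⟩, ⟨_, l₂⟩, ⟨_, l₃⟩, ⟨_, l₄⟩, ⊤]
      step := fun i => by
        fin_cases i
        exacts [h₀, h₁, h₂, h₃, h₄] }
  rw [moduleLength, Order.krullDim_eq_of_orderIso (Submodule.comapMkQRelIso _)]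
  exact Order.LTSeries.length_le_krullDim s

end ForkLength

theorem length_of_local_three_factor_serial
    (R : Type*) [CommRing R] [IsArtinianRing R]
    (Λ : Type u) [Ring Λ] [Algebra R Λ] [Module.Finite R Λ]
    (hΛ : IsRightNNakayama Λ 4)
    (M : Type u) [AddCommGroup M] [Module Λᵐᵒᵖ M] [Module.Finite Λᵐᵒᵖ M]
    (hind : IsIndecModule Λᵐᵒᵖ M) (hloc : IsLocalModule Λᵐᵒᵖ M)
    (hfs : IsNFactorSerial Λᵐᵒᵖ M 3) :
    moduleLength Λᵐᵒᵖ M = 4 := by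
  obtain ⟨-, hM, l, hl, hl3, huni, hnot⟩ := hfs
  have := isNoetherian_of_moduleLength_eq hl
  obtain ⟨n, rfl⟩ := Nat.exists_eq_add_of_le' hl3
  rw [Nat.add_sub_cancel] at huni hnot
  obtain ⟨Q, R, hQ, hR, hQR⟩ := exists_covBy_radPow hM huni hnot
  match n with
  | 0 => exact absurd (hloc.unique (covBy_top_iff.1 hQ) (covBy_top_iff.1 hR)) hQR
  | 1 => exact hl
  | n + 2 =>
    have hfork := exists_isFork hM huni hQ hR hQR
    obtain ⟨i, -, hi, hser⟩ :=
      hΛ.1 (ModuleCat.of _ (Glue _ _ _)) (inferInstanceAs (Module.Finite _ (Glue _ _ _)))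
        hfork.isIndecModule_glue
    have hlen := hser.moduleLength_eq hfork.isCoatom_ker_glueFst hfork.isCoatom_ker_glueSnd
      hfork.ker_glueFst_ne_ker_glueSnd
    have h5 := hfork.five_le_moduleLength_glue
    have h5i : ((5 : ℕ) : WithBot ℕ∞) ≤ (i : ℕ) := hlen ▸ h5
    have : 5 ≤ i := by exact_mod_cast h5i
    omega
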